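/- arXiv:2604.09730 — 2 statements merged into one kernel-verified Lean document; each statement's English description precedes it below -/
import Mathlib

section
/- Let l be a fixed positive integer. There exists n_0 such that for all even n ≥ n_0 with a_1 = n - l odd, there is a prime p with n/2 < p ≤ a_1; consequently the equation a_1!!·a_2!!···a_t!! = n!! with a_2,...,a_t even has no solution with n ≥ n_0 and n - a_1 = l. -/
open Nat Finset

/-- If all primes in `(m, 2 * m]` exceed `2 * m - l`, then the central binomial coefficient
satisfies the bound from the proof of Bertrand's postulate up to a factor `(2 * m) ^ l`. -/
theorem centralBinom_le_of_no_prime_le_sub {m l : ℕ} (hm : 2 < m)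
    (no_prime : ∀ p : ℕ, p.Prime → m < p → 2 * m - l < p) :
    centralBinom m ≤ (2 * m) ^ (Nat.sqrt (2 * m) + l) * 4 ^ (2 * m / 3) := by
  set A : Finset ℕ := Icc 1 (Nat.sqrt (2 * m)) ∪ Ioc (2 * m - l) (2 * m) with hA
  have hcard : #A ≤ Nat.sqrt (2 * m) + l := by
    refine (card_union_le _ _).trans ?_
    simp only [card_Icc, card_Ioc]
    lia
  have pointwise : ∀ p ∈ range (2 * m + 1), p ^ (centralBinom m).factorization p ≤
      (if p ∈ A then 2 * m else 1) * (if p.Prime ∧ p ≤ 2 * m / 3 then p else 1) := by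
    intro p hp
    have hsnd : 1 ≤ if p.Prime ∧ p ≤ 2 * m / 3 then p else 1 := by
      split_ifs with h
      · exact h.1.one_le
      · exact le_rfl
    by_cases hprime : p.Prime
    swap
    · rw [factorization_eq_zero_of_not_prime _ hprime, pow_zero]
      refine Nat.mul_pos ?_ hsnd
      split_ifs <;> lia
    by_cases hpA : p ∈ A
    · rw [if_pos hpA]
      exact (pow_factorization_choose_le (by lia)).trans (Nat.le_mul_of_pos_right _ hsnd)
    rw [if_neg hpA, one_mul]
    simp only [hA, mem_union, mem_Icc, mem_Ioc, mem_range] at hpA hp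
    have hpos := hprime.one_le
    have hpm : p ≤ m := by
      by_contra! h
      have := no_prime p hprime h
      lia
    by_cases hp3 : 2 * m < 3 * p
    · rwa [factorization_centralBinom_of_two_mul_self_lt_three_mul hm hpm hp3, pow_zero]
    · rw [if_pos ⟨hprime, by lia⟩]
      have hexp : (centralBinom m).factorization p ≤ 1 :=
        factorization_choose_le_one (Nat.sqrt_lt'.mp (by lia))
      exact (Nat.pow_le_pow_right hpos hexp).trans (pow_one p).le
  rw [← prod_pow_factorization_centralBinom m]
  refine (prod_le_prod' pointwise).trans ?_
  rw [prod_mul_distrib]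
  refine Nat.mul_le_mul ?_ ?_
  · rw [← prod_filter, prod_const]
    refine Nat.pow_le_pow_right (by lia) ((card_le_card ?_).trans hcard)
    exact fun p hp => (mem_filter.1 hp).2
  · rw [← prod_filter]
    refine le_trans ?_ (primorial_le_four_pow (2 * m / 3))
    refine prod_le_prod_of_subset_of_one_le' (fun p hp => ?_) fun p hp _ => ?_
    · simp only [mem_filter, mem_range] at hp ⊢
      exact ⟨by lia, hp.2.1⟩
    · exact (mem_filter.1 hp).2.one_le

/-- The inequality contradicting the absence of primes in `(m, 2 * m - l]` for large `m`. -/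
theorem eventually_mul_pow_sqrt_add_mul_four_pow_le (l : ℕ) :
    ∀ᶠ m : ℕ in Filter.atTop,
      m * ((2 * m) ^ (Nat.sqrt (2 * m) + l) * 4 ^ (2 * m / 3)) ≤ 4 ^ m := by
  have hx : Filter.Tendsto (fun m : ℕ => 2 * (m : ℝ)) Filter.atTop Filter.atTop :=
    tendsto_natCast_atTop_atTop.const_mul_atTop two_pos
  have hlog : ∀ᶠ x : ℝ in Filter.atTop, ‖Real.log x‖ ≤ 1 / 16 * ‖x ^ (1 / 2 : ℝ)‖ :=
    (isLittleO_log_rpow_atTop one_half_pos).bound (by norm_num)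
  have hsqrt : ∀ᶠ x : ℝ in Filter.atTop, (l + 1 : ℝ) ≤ √x :=
    Real.tendsto_sqrt_atTop.eventually_ge_atTop _
  filter_upwards [hx.eventually hlog, hx.eventually hsqrt, Filter.eventually_ge_atTop 1]
    with m hlog hsqrt hm
  have hm' : (1 : ℝ) ≤ m := by exact_mod_cast hm
  rw [← Real.sqrt_eq_rpow, Real.norm_of_nonneg (Real.log_nonneg (by linarith)),
    Real.norm_of_nonneg (Real.sqrt_nonneg _)] at hlog
  have hlogm : Real.log m ≤ Real.log (2 * m) := Real.log_le_log (by linarith) (by linarith)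
  have hlog2m : 0 ≤ Real.log (2 * m) := Real.log_nonneg (by linarith)
  have hlog4 : (1 : ℝ) ≤ Real.log 4 := by
    rw [show (4 : ℝ) = 2 ^ 2 by norm_num, Real.log_pow]
    have := Real.log_two_gt_d9
    push_cast
    linarith
  have hfloor : ((2 * m / 3 : ℕ) : ℝ) ≤ 2 * m / 3 := by
    simpa using Nat.cast_div_le (α := ℝ) (m := 2 * m) (n := 3)
  have hnatsqrt : (Nat.sqrt (2 * m) : ℝ) ≤ √(2 * m) := by
    simpa using Real.nat_sqrt_le_real_sqrt (a := 2 * m)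
  have hsq : √(2 * m : ℝ) * √(2 * m) = 2 * m := Real.mul_self_sqrt (by linarith)
  have hmain : (Nat.sqrt (2 * m) + l + 1) * Real.log (2 * m) ≤ m / 4 := by
    calc (Nat.sqrt (2 * m) + l + 1) * Real.log (2 * m)
        ≤ (2 * √(2 * m)) * (1 / 16 * √(2 * m)) := by
          gcongr
          linarith
      _ = m / 4 := by linear_combination (1 / 8 : ℝ) * hsq
  have hfour : ((2 * m / 3 : ℕ) : ℝ) * Real.log 4 ≤ 2 * m / 3 * Real.log 4 := by gcongr
  have hm4 : (m : ℝ) ≤ m * Real.log 4 := le_mul_of_one_le_right (by linarith) hlog4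
  rw [← Nat.cast_le (α := ℝ)]
  push_cast
  rw [← Real.log_le_log_iff (by positivity) (by positivity),
    Real.log_mul (by positivity) (by positivity), Real.log_mul (by positivity) (by positivity),
    Real.log_pow, Real.log_pow, Real.log_pow]
  push_cast
  linarith

/-- Bertrand's postulate with the upper end of the interval lowered by a constant. -/
theorem eventually_exists_prime_lt_and_le_two_mul_sub (l : ℕ) :
    ∀ᶠ m : ℕ in Filter.atTop, ∃ p : ℕ, p.Prime ∧ m < p ∧ p ≤ 2 * m - l := by
  filter_upwards [eventually_mul_pow_sqrt_add_mul_four_pow_le l, Filter.eventually_ge_atTop 4]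
    with m hle hm
  by_contra! no_prime
  have hlt := four_pow_lt_mul_centralBinom m hm
  have hbinom := centralBinom_le_of_no_prime_le_sub (by lia) no_prime
  exact absurd (hlt.trans_le ((Nat.mul_le_mul_left m hbinom).trans hle)) (lt_irrefl _)

/-- An odd number divides the double factorial of every odd number that is at least as large. -/
theorem Odd.dvd_doubleFactorial {k n : ℕ} (hk : Odd k) (hn : Odd n) (hkn : k ≤ n) : k ∣ n‼ := by
  obtain ⟨i, rfl⟩ := hk
  obtain ⟨j, rfl⟩ := hn
  induction j with
  | zero =>
    obtain rfl : i = 0 := by lia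
    simp
  | succ j ih =>
    rw [show 2 * (j + 1) + 1 = 2 * j + 1 + 2 by ring, doubleFactorial_add_two]
    rcases (show i ≤ j ∨ i = j + 1 by lia) with h | rfl
    · exact (ih (by lia)).mul_left _
    · exact Dvd.intro _ rfl

/-- An odd prime larger than `m` does not divide `(2 * m)‼`. -/
theorem Nat.Prime.not_dvd_doubleFactorial_two_mul {p m : ℕ} (hp : p.Prime) (hodd : p ≠ 2)
    (hmp : m < p) : ¬ p ∣ (2 * m)‼ := by
  rw [doubleFactorial_two_mul, hp.dvd_mul, hp.dvd_factorial, not_or, not_le]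
  exact ⟨fun h => hodd ((prime_dvd_prime_iff_eq hp prime_two).1 (hp.dvd_of_dvd_pow h)), hmp⟩

theorem no_solution_fixed_gap (l : ℕ) (hl : 0 < l) :
    ∃ n₀ : ℕ, ∀ n : ℕ, n₀ ≤ n → Even n → Odd (n - l) →
      (∃ p : ℕ, p.Prime ∧ n / 2 < p ∧ p ≤ n - l) ∧
      ∀ (t : ℕ) (a : Fin t → ℕ), (∀ i, Even (a i)) →
        (n - l)‼ * ∏ i, (a i)‼ ≠ n‼ := by
  obtain ⟨m₀, hm₀⟩ := Filter.eventually_atTop.1 (eventually_exists_prime_lt_and_le_two_mul_sub l)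
  refine ⟨2 * m₀ + 4, fun n hn heven hodd => ?_⟩
  obtain ⟨m, rfl⟩ := heven.two_dvd
  obtain ⟨p, hp, hmp, hpl⟩ := hm₀ m (by lia)
  refine ⟨⟨p, hp, by lia, hpl⟩, fun t a _ heq => ?_⟩
  have hp2 : p ≠ 2 := by lia
  refine hp.not_dvd_doubleFactorial_two_mul hp2 hmp ?_
  rw [← heq]
  exact ((hp.odd_of_ne_two hp2).dvd_doubleFactorial hodd hpl).mul_right _
end

section
/- Assume the explicit abc inequality c < N(abc)^{7/4} for all coprime positive integers a + b = c. Let x ≥ 2 and 0 ≤ j_2 < j_1 < k with d = gcd(x+j_1, j_1-j_2). Then x/d ≤ (N(x+j_1)·N(x+j_2)·(j_1-j_2)/d)^{7/4}. -/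
open Nat Finset

/-- The radical of a positive integer: the product of its prime divisors. -/
def rad (a : ℕ) : ℕ := ∏ p ∈ a.primeFactors, p

theorem rad_eq_radical (n : ℕ) : rad n = UniqueFactorizationMonoid.radical n :=
  Nat.radical_eq_prod_primeFactors.symm

theorem rad_mul_le (a b : ℕ) : rad (a * b) ≤ rad a * rad b := by
  simp only [rad_eq_radical]
  exact Nat.le_of_dvd (Nat.mul_pos (Nat.radical_pos a) (Nat.radical_pos b))
    UniqueFactorizationMonoid.radical_mul_dvd

theorem rad_le_rad_of_dvd {a b : ℕ} (h : a ∣ b) (hb : b ≠ 0) : rad a ≤ rad b := by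
  simp only [rad_eq_radical]
  exact Nat.le_of_dvd (Nat.radical_pos b) (UniqueFactorizationMonoid.radical_dvd_radical h hb)

theorem rad_le_self {a : ℕ} (ha : a ≠ 0) : rad a ≤ a := by
  simpa only [rad_eq_radical] using Nat.radical_le_self_iff.mpr ha

theorem abc_applied (habc : ∀ a b c : ℕ, 0 < a → 0 < b → a + b = c →
      Nat.Coprime a b → (c : ℝ) < (rad (a * b * c) : ℝ) ^ ((7 : ℝ) / 4))
    (x k j₁ j₂ d : ℕ) (hx : 2 ≤ x) (hj : j₂ < j₁) (hk : j₁ < k)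
    (hd : d = Nat.gcd (x + j₁) (j₁ - j₂)) :
    (x : ℝ) / d ≤
      ((rad (x + j₁) : ℝ) * rad (x + j₂) * ((j₁ - j₂) / d : ℕ)) ^ ((7 : ℝ) / 4) := by
  have hd0 : 0 < d := hd ▸ Nat.gcd_pos_of_pos_left _ (by omega)
  obtain ⟨c, hc⟩ : d ∣ x + j₁ := hd ▸ Nat.gcd_dvd_left _ _
  obtain ⟨b, hb⟩ : d ∣ j₁ - j₂ := hd ▸ Nat.gcd_dvd_right _ _
  have hcb : Nat.Coprime c b := by
    rw [hc, hb, Nat.gcd_mul_left] at hd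
    exact Nat.eq_of_mul_eq_mul_left hd0 (by rw [← hd, mul_one])
  have hb0 : 0 < b := Nat.pos_of_mul_pos_left (a := d) (by omega)
  have hlt : b < c := Nat.lt_of_mul_lt_mul_left (a := d) (by omega)
  obtain ⟨a, rfl⟩ := Nat.exists_eq_add_of_lt hlt
  have ha : x + j₂ = d * (a + 1) := by
    have : d * (b + a + 1) = d * b + d * (a + 1) := by ring
    omega
  have hquot : (j₁ - j₂) / d = b := by rw [hb, Nat.mul_div_cancel_left _ hd0]
  have hcop : Nat.Coprime (a + 1) b := by
    rwa [add_assoc, Nat.coprime_self_add_left] at hcb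
  have key := habc (a + 1) b (b + a + 1) (by omega) hb0 (by ring) hcop
  have hrad : rad ((a + 1) * b * (b + a + 1)) ≤ rad (x + j₁) * rad (x + j₂) * b :=
    calc rad ((a + 1) * b * (b + a + 1))
        ≤ rad (a + 1) * rad b * rad (b + a + 1) :=
          (rad_mul_le _ _).trans (Nat.mul_le_mul_right _ (rad_mul_le _ _))
      _ ≤ rad (x + j₂) * b * rad (x + j₁) := by
          gcongr
          · exact rad_le_rad_of_dvd ⟨d, by rw [ha, mul_comm]⟩ (by omega)
          · exact rad_le_self hb0.ne'
          · exact rad_le_rad_of_dvd ⟨d, by rw [hc, mul_comm]⟩ (by omega)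
      _ = rad (x + j₁) * rad (x + j₂) * b := by ring
  have hxc : (x : ℝ) / d ≤ (b + a + 1 : ℕ) := by
    rw [div_le_iff₀ (by exact_mod_cast hd0), mul_comm]
    exact_mod_cast hc ▸ Nat.le_add_right x j₁
  rw [hquot]
  refine hxc.trans (key.le.trans ?_)
  exact Real.rpow_le_rpow (by positivity) (by exact_mod_cast hrad) (by norm_num)
end
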